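/- arXiv:quant-ph/0409024 — 5 statements merged into one kernel-verified Lean document; each statement's English description precedes it below -/
import Mathlib

section
/- Let A and B be d×d Hermitian matrices, with eigenvalues of A listed in decreasing order a_1 ≥ a_2 ≥ … ≥ a_d and eigenvalues of B listed in increasing order b_1 ≤ b_2 ≤ … ≤ b_d (each with multiplicity). Then tr(AB) ≥ Σ_{k=1}^{d} a_k · b_k. -/
theorem diag_of_eigen {d : ℕ} (A : Matrix (Fin d) (Fin d) ℂ) (a : Fin d → ℝ)
    (u : Fin d → EuclideanSpace ℂ (Fin d)) (hu : Orthonormal ℂ u)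
    (hAu : ∀ k, Matrix.toEuclideanLin A (u k) = (a k : ℂ) • u k) :
    ∃ U : Matrix (Fin d) (Fin d) ℂ, U.conjTranspose * U = 1 ∧ U * U.conjTranspose = 1 ∧
      A = U * Matrix.diagonal (fun k => (a k : ℂ)) * U.conjTranspose := by
  have h1 : (Matrix.of fun i k => u k i).conjTranspose * (Matrix.of fun i k => u k i) = 1 := by
    ext i j
    have := (orthonormal_iff_ite.mp hu) i j
    rw [Matrix.one_apply, ← this]
    simp [Matrix.mul_apply, PiLp.inner_apply, mul_comm]
  have h2 := mul_eq_one_comm.mp h1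
  refine ⟨Matrix.of fun i k => u k i, h1, h2, ?_⟩
  have h3 : A * (Matrix.of fun i k => u k i) =
      (Matrix.of fun i k => u k i) * Matrix.diagonal (fun k => (a k : ℂ)) := by
    ext i k
    have := congrArg (fun v : EuclideanSpace ℂ (Fin d) => v i) (hAu k)
    simp only [Matrix.toLpLin_apply, Matrix.mulVec, dotProduct, PiLp.smul_apply,
      smul_eq_mul] at this
    rw [Matrix.mul_diagonal, Matrix.mul_apply]
    simpa [mul_comm] using this
  rw [← h3, Matrix.mul_assoc, h2, Matrix.mul_one]

theorem ds_bound {d : ℕ} (a b : Fin d → ℝ) (ha : Antitone a) (hb : Monotone b)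
    (M : Matrix (Fin d) (Fin d) ℝ) (hM : M ∈ doublyStochastic ℝ (Fin d)) :
    ∑ k, a k * b k ≤ ∑ i, ∑ j, a i * b j * M i j := by
  obtain ⟨c, hc, hs, rfl⟩ := exists_eq_sum_perm_of_mem_doublyStochastic hM
  have key : ∑ i, ∑ j, a i * b j * (∑ σ, c σ • σ.permMatrix ℝ : Matrix (Fin d) (Fin d) ℝ) i j
      = ∑ σ, c σ * ∑ i, a i * b (σ i) := by
    simp only [Matrix.sum_apply, Matrix.smul_apply, Finset.mul_sum, smul_eq_mul]
    rw [Finset.sum_congr rfl fun i _ => Finset.sum_comm, Finset.sum_comm]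
    refine Finset.sum_congr rfl fun σ _ => Finset.sum_congr rfl fun i _ => ?_
    simp [Equiv.Perm.permMatrix, PEquiv.toMatrix_apply, mul_comm, mul_left_comm]
  have hab : Antivary a b := ha.antivary hb
  rw [key, ← one_mul (∑ k, a k * b k), ← hs, Finset.sum_mul]
  exact Finset.sum_le_sum fun σ _ =>
    mul_le_mul_of_nonneg_left hab.sum_mul_le_sum_mul_comp_perm (hc σ)

theorem ds_of_unitary {d : ℕ} (V : Matrix (Fin d) (Fin d) ℂ)
    (h1 : V.conjTranspose * V = 1) (h2 : V * V.conjTranspose = 1) :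
    (Matrix.of fun i j => Complex.normSq (V i j)) ∈ doublyStochastic ℝ (Fin d) := by
  rw [mem_doublyStochastic_iff_sum]
  refine ⟨fun i j => Complex.normSq_nonneg _, fun i => ?_, fun j => ?_⟩
  · have := congrFun (congrFun h2 i) i
    simp only [Matrix.mul_apply, Matrix.conjTranspose_apply, Matrix.one_apply_eq,
      Complex.star_def, Complex.mul_conj] at this
    exact_mod_cast this
  · have := congrFun (congrFun h1 j) j
    simp only [Matrix.mul_apply, Matrix.conjTranspose_apply, Matrix.one_apply_eq,
      Complex.star_def, ← Complex.normSq_eq_conj_mul_self] at this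
    exact_mod_cast this

/-- **Lower half of the von Neumann trace inequality.**
Let `A` and `B` be `d × d` Hermitian matrices, with the eigenvalues of `A` listed in
decreasing order `a 0 ≥ a 1 ≥ … ≥ a (d-1)` and the eigenvalues of `B` listed in
increasing order `b 0 ≤ b 1 ≤ … ≤ b (d-1)` (each with multiplicity, witnessed by
orthonormal eigenbases `u` and `w`).  Then `tr (A B) ≥ ∑ k, a k · b k`. -/
theorem stmt_2 (d : ℕ)
    (A B : Matrix (Fin d) (Fin d) ℂ)
    (hA : A.IsHermitian) (hB : B.IsHermitian)
    (a : Fin d → ℝ) (ha : Antitone a)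
    (b : Fin d → ℝ) (hb : Monotone b)
    (u : Fin d → EuclideanSpace ℂ (Fin d))
    (hu : Orthonormal ℂ u)
    (hAu : ∀ k, Matrix.toEuclideanLin A (u k) = (a k : ℂ) • u k)
    (w : Fin d → EuclideanSpace ℂ (Fin d))
    (hw : Orthonormal ℂ w)
    (hBw : ∀ k, Matrix.toEuclideanLin B (w k) = (b k : ℂ) • w k) :
    ∑ k : Fin d, a k * b k ≤ ((A * B).trace).re := by
  obtain ⟨U, hU1, hU2, rfl⟩ := diag_of_eigen A a u hu hAu
  obtain ⟨W, hW1, hW2, rfl⟩ := diag_of_eigen B b w hw hBw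
  set V := U.conjTranspose * W with hV
  have hVc : V.conjTranspose = W.conjTranspose * U := by simp [hV]
  have h1 : V.conjTranspose * V = 1 := by
    rw [hVc, hV, Matrix.mul_assoc, ← Matrix.mul_assoc U, hU2, Matrix.one_mul, hW1]
  have h2 : V * V.conjTranspose = 1 := mul_eq_one_comm.mp h1
  have h := ds_bound a b ha hb _ (ds_of_unitary V h1 h2)
  have ht : (U * Matrix.diagonal (fun k => (a k : ℂ)) * U.conjTranspose *
      (W * Matrix.diagonal (fun k => (b k : ℂ)) * W.conjTranspose)).trace =
      ((∑ i, ∑ j, a i * b j * Complex.normSq (V i j) : ℝ) : ℂ) := by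
    have e : U * Matrix.diagonal (fun k => (a k : ℂ)) * U.conjTranspose *
      (W * Matrix.diagonal (fun k => (b k : ℂ)) * W.conjTranspose) =
      U * (Matrix.diagonal (fun k => (a k : ℂ)) * V *
        (Matrix.diagonal (fun k => (b k : ℂ)) * W.conjTranspose)) := by
      simp only [hV, Matrix.mul_assoc]
    rw [e, Matrix.trace_mul_comm, Matrix.mul_assoc,
      Matrix.mul_assoc (Matrix.diagonal (fun k => (b k : ℂ))), ← hVc, Matrix.trace]
    push_cast
    refine Finset.sum_congr rfl fun i _ => ?_
    rw [Matrix.diag_apply, Matrix.mul_apply]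
    refine Finset.sum_congr rfl fun j _ => ?_
    rw [Matrix.diagonal_mul, Matrix.diagonal_mul, Matrix.conjTranspose_apply,
      Complex.star_def, ← Complex.mul_conj]
    ring
  rw [ht, Complex.ofReal_re]
  exact h
end

section
/- Let n ≥ 2 and let H be a Hermitian matrix on the n-qubit space that is a finite sum of Hermitian terms, each of which acts as the identity on at least one qubit (in particular, any k-local Hamiltonian with k ≤ n−1 is of this form). If GHZ_n is an eigenvector of H with eigenvalue E_0 equal to the minimal eigenvalue of H, then e_{0…0} and e_{1…1} are also eigenvectors of H with eigenvalue E_0; in particular the E_0-eigenspace of H has dimension at least 2, so GHZ_n cannot be a non-degenerate ground state of H. -/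
/-- The matrix `h` on the `n`-qubit space acts as the identity on qubit `i`:
its entries vanish unless the `i`-th bits agree, and do not depend on the common
value of that bit. -/
def ActsIdOn (n : ℕ) (h : Matrix (Fin n → Bool) (Fin n → Bool) ℂ) (i : Fin n) : Prop :=
  (∀ x y, x i ≠ y i → h x y = 0) ∧
  (∀ x y (b b' : Bool),
    h (Function.update x i b) (Function.update y i b)
      = h (Function.update x i b') (Function.update y i b'))

/-- The all-zeros computational basis string. -/
def allZeros (n : ℕ) : Fin n → Bool := fun _ => false

/-- The all-ones computational basis string. -/
def allOnes (n : ℕ) : Fin n → Bool := fun _ => true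

/-- The `n`-qubit GHZ state `(e_{0…0} + e_{1…1})/√2`. -/
noncomputable def ghz (n : ℕ) : EuclideanSpace ℂ (Fin n → Bool) :=
  ((Real.sqrt 2 : ℂ))⁻¹ •
    (EuclideanSpace.single (allZeros n) 1 + EuclideanSpace.single (allOnes n) 1)

open scoped ComplexOrder

/-- Let `n ≥ 2` and let `H` be a Hermitian matrix on the `n`-qubit space that is a finite
sum of Hermitian terms, each of which acts as the identity on at least one qubit.  If
`GHZ_n` is an eigenvector of `H` with eigenvalue `E₀` equal to the minimal eigenvalue of
`H`, then `e_{0…0}` and `e_{1…1}` are also eigenvectors of `H` with eigenvalue `E₀`;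
in particular the `E₀`-eigenspace of `H` has dimension at least `2`, so `GHZ_n` cannot be
a non-degenerate ground state of `H`. -/
theorem stmt_4 (n : ℕ) (hn : 2 ≤ n) (m : ℕ)
    (h : Fin m → Matrix (Fin n → Bool) (Fin n → Bool) ℂ)
    (q : Fin m → Fin n)
    (hherm : ∀ j, (h j).IsHermitian)
    (hloc : ∀ j, ActsIdOn n (h j) (q j))
    (H : Matrix (Fin n → Bool) (Fin n → Bool) ℂ)
    (hH : H = ∑ j, h j)
    (E0 : ℝ)
    (hground : Matrix.toEuclideanLin H (ghz n) = (E0 : ℂ) • ghz n)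
    (hmin : ∀ (μ : ℝ) (w : EuclideanSpace ℂ (Fin n → Bool)),
      w ≠ 0 → Matrix.toEuclideanLin H w = (μ : ℂ) • w → E0 ≤ μ) :
    Matrix.toEuclideanLin H (EuclideanSpace.single (allZeros n) 1)
      = (E0 : ℂ) • EuclideanSpace.single (allZeros n) 1 ∧
    Matrix.toEuclideanLin H (EuclideanSpace.single (allOnes n) 1)
      = (E0 : ℂ) • EuclideanSpace.single (allOnes n) 1 ∧
    2 ≤ Module.finrank ℂ
      (Module.End.eigenspace (Matrix.toEuclideanLin H) ((E0 : ℝ) : ℂ)) := by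
  have hHh : H.IsHermitian := by
    rw [hH]
    unfold Matrix.IsHermitian
    rw [Matrix.conjTranspose_sum]
    exact Finset.sum_congr rfl fun j _ => hherm j
  have h01 : H (allZeros n) (allOnes n) = 0 := by
    rw [hH, Matrix.sum_apply]
    exact Finset.sum_eq_zero fun j _ => (hloc j).1 _ _ (by simp [allZeros, allOnes])
  have h10 : H (allOnes n) (allZeros n) = 0 := by
    rw [hH, Matrix.sum_apply]
    exact Finset.sum_eq_zero fun j _ => (hloc j).1 _ _ (by simp [allZeros, allOnes])
  have hne : allZeros n ≠ allOnes n := fun e => by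
    have := congrFun e ⟨0, by omega⟩
    simp [allZeros, allOnes] at this
  have hs : ((Real.sqrt 2 : ℝ) : ℂ)⁻¹ ≠ 0 := by
    apply inv_ne_zero
    exact_mod_cast (Real.sqrt_pos.mpr (by norm_num : (0:ℝ) < 2)).ne'
  have hg : Matrix.toEuclideanLin H
      (EuclideanSpace.single (allZeros n) 1 + EuclideanSpace.single (allOnes n) 1) =
      (E0 : ℂ) • (EuclideanSpace.single (allZeros n) 1 + EuclideanSpace.single (allOnes n) 1) := by
    unfold ghz at hground
    rw [map_smul, smul_comm] at hground
    exact smul_right_injective _ hs hground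
  have hcol : ∀ x y, (Matrix.toEuclideanLin H (EuclideanSpace.single x 1)) y = H y x := by
    intro x y
    simp [Matrix.toLpLin_apply]
  have h00 : H (allZeros n) (allZeros n) = E0 := by
    have := congrArg (fun v => v (allZeros n)) hg
    simpa [map_add, hcol, h01, hne] using this
  have h11 : H (allOnes n) (allOnes n) = E0 := by
    have := congrArg (fun v => v (allOnes n)) hg
    simpa [map_add, hcol, h10, hne.symm] using this
  have hAh : (H - (E0 : ℂ) • (1 : Matrix (Fin n → Bool) (Fin n → Bool) ℂ)).IsHermitian := by
    apply hHh.sub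
    simp [Matrix.IsHermitian, Matrix.conjTranspose_smul]
  have hpsd : (H - (E0 : ℂ) • (1 : Matrix (Fin n → Bool) (Fin n → Bool) ℂ)).PosSemidef := by
    rw [hAh.posSemidef_iff_eigenvalues_nonneg]
    intro k
    have h1 := hAh.mulVec_eigenvectorBasis k
    have h2 := hmin (hAh.eigenvalues k + E0) (hAh.eigenvectorBasis k)
      (hAh.eigenvectorBasis.orthonormal.ne_zero k) (by
        ext y
        have h3 := congrFun h1 y
        simp only [Matrix.sub_mulVec, Matrix.smul_mulVec, Matrix.one_mulVec, Pi.sub_apply,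
          Pi.smul_apply, Complex.real_smul, smul_eq_mul] at h3
        simp only [Matrix.toLpLin_apply, PiLp.smul_apply, smul_eq_mul, Complex.ofReal_add]
        linear_combination h3)
    simp only [Pi.zero_apply]
    linarith
  have key : ∀ x, H x x = E0 → Matrix.toEuclideanLin H (EuclideanSpace.single x 1)
      = (E0 : ℂ) • EuclideanSpace.single x 1 := by
    intro x hx
    have h1 := (hpsd.dotProduct_mulVec_zero_iff (Pi.single x 1)).1 (by
      simp [hx])
    ext y
    have h3 := congrFun h1 y
    rw [hcol]
    simp only [Matrix.mulVec_single_one, Matrix.col_apply, Pi.zero_apply, Matrix.sub_apply,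
      Matrix.smul_apply, Matrix.one_apply, smul_eq_mul] at h3
    simp only [PiLp.smul_apply, smul_eq_mul, PiLp.single_apply]
    linear_combination h3
  have k0 := key _ h00
  have k1 := key _ h11
  refine ⟨k0, k1, ?_⟩
  let v : Fin 2 → Module.End.eigenspace (Matrix.toEuclideanLin H) ((E0 : ℝ) : ℂ) :=
    ![⟨_, Module.End.mem_eigenspace_iff.2 k0⟩, ⟨_, Module.End.mem_eigenspace_iff.2 k1⟩]
  have hv : LinearIndependent ℂ v := by
    rw [LinearIndependent.pair_iff]
    intro s t hst
    have hst' := congrArg Subtype.val hst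
    simp only [Submodule.coe_add, Submodule.coe_smul, Submodule.coe_zero] at hst'
    have e0 := congrArg (fun v => v (allZeros n)) hst'
    have e1 := congrArg (fun v => v (allOnes n)) hst'
    simp [hne, hne.symm] at e0 e1
    exact ⟨e0, e1⟩
  simpa using hv.fintype_card_le_finrank
end

section
/- Every Hermitian matrix H on ℂ² ⊗ ℂ² ⊗ ℂ² can be written in the form H = Y + Σ_{m=1}^{M} ε_m · B_{m1} ⊗ B_{m2} ⊗ B_{m3}, where M is finite, each ε_m ∈ {+1, −1}, each B_{mk} is a positive semidefinite Hermitian 2×2 matrix, and Y is a finite sum of Hermitian matrices each of which is 2-local, i.e. of one of the forms A ⊗ B ⊗ I₂, A ⊗ I₂ ⊗ B, or I₂ ⊗ A ⊗ B with A, B 2×2 Hermitian. -/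
open Matrix Kronecker
open scoped ComplexOrder

/-- The three-qubit space index: `(Fin 2 × Fin 2) × Fin 2` (left-associated Kronecker). -/
abbrev Q3 : Type := (Fin 2 × Fin 2) × Fin 2

/-- A Hermitian 2-local term on three qubits: of one of the forms `A ⊗ B ⊗ I₂`,
`A ⊗ I₂ ⊗ B`, or `I₂ ⊗ A ⊗ B` with `A`, `B` Hermitian `2×2` matrices. -/
def IsTwoLocalTerm (h : Matrix Q3 Q3 ℂ) : Prop :=
  ∃ A B : Matrix (Fin 2) (Fin 2) ℂ, A.IsHermitian ∧ B.IsHermitian ∧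
    (h = A ⊗ₖ B ⊗ₖ (1 : Matrix (Fin 2) (Fin 2) ℂ) ∨
     h = A ⊗ₖ (1 : Matrix (Fin 2) (Fin 2) ℂ) ⊗ₖ B ∨
     h = (1 : Matrix (Fin 2) (Fin 2) ℂ) ⊗ₖ A ⊗ₖ B)

/-- `X` is a signed finite sum of tensor products of PSD matrices. -/
def Good (X : Matrix Q3 Q3 ℂ) : Prop :=
  ∃ (M : ℕ) (ε : Fin M → ℝ) (B : Fin M → Fin 3 → Matrix (Fin 2) (Fin 2) ℂ),
      (∀ m, ε m = 1 ∨ ε m = -1) ∧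
      (∀ m j, (B m j).PosSemidef) ∧
      X = ∑ m, ((ε m : ℝ) : ℂ) • (B m 0 ⊗ₖ B m 1 ⊗ₖ B m 2)

lemma Good.add {X Y : Matrix Q3 Q3 ℂ} (hX : Good X) (hY : Good Y) : Good (X + Y) := by
  obtain ⟨M, ε, B, h1, h2, rfl⟩ := hX
  obtain ⟨N, δ, C, h3, h4, rfl⟩ := hY
  refine ⟨M + N, Fin.append ε δ, Fin.append B C, ?_, ?_, ?_⟩
  · intro m
    refine Fin.addCases (fun i => ?_) (fun i => ?_) m
    · simpa using h1 i
    · simpa using h3 i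
  · intro m
    refine Fin.addCases (fun i => ?_) (fun i => ?_) m
    · simpa using h2 i
    · simpa using h4 i
  · rw [Fin.sum_univ_add]
    simp

lemma Good.zero : Good 0 :=
  ⟨0, fun _ => 1, fun _ _ => 0, fun m => m.elim0, fun m => m.elim0, by simp⟩

lemma Good.term (r : ℝ) {A B C : Matrix (Fin 2) (Fin 2) ℂ} (hA : A.PosSemidef)
    (hB : B.PosSemidef) (hC : C.PosSemidef) : Good ((r : ℂ) • (A ⊗ₖ B ⊗ₖ C)) := by
  have key : ∀ (e s : ℝ), (e = 1 ∨ e = -1) → 0 ≤ s → r = e * s →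
      Good ((r : ℂ) • (A ⊗ₖ B ⊗ₖ C)) := by
    intro e s he hs hr
    refine ⟨1, fun _ => e, fun _ => ![(s : ℂ) • A, B, C], fun _ => he, ?_, ?_⟩
    · intro _ j
      fin_cases j
      · exact hA.smul (by exact_mod_cast hs)
      · exact hB
      · exact hC
    · simp [hr, smul_kronecker, mul_smul]
  rcases le_total 0 r with h | h
  · exact key 1 r (Or.inl rfl) h (by ring)
  · exact key (-1) (-r) (Or.inr rfl) (by linarith) (by ring)

/-- PSD matrices span all 2×2 complex matrices. -/
lemma psd_span (R : Submodule ℂ (Matrix (Fin 2) (Fin 2) ℂ))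
    (h : ∀ A : Matrix (Fin 2) (Fin 2) ℂ, A.PosSemidef → A ∈ R) (A) : A ∈ R := by
  have hv : ∀ v : Fin 2 → ℂ, vecMulVec v (star v) ∈ R :=
    fun v => h _ (posSemidef_vecMulVec_self_star v)
  have e : A = (A 0 0 - (A 0 1 + A 1 0) / 2 - (A 0 1 - A 1 0) * Complex.I / 2)
        • vecMulVec ![1, 0] (star ![1, 0])
      + (A 1 1 - (A 0 1 + A 1 0) / 2 - (A 0 1 - A 1 0) * Complex.I / 2)
        • vecMulVec ![0, 1] (star ![0, 1])
      + ((A 0 1 + A 1 0) / 2) • vecMulVec ![1, 1] (star ![1, 1])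
      + ((A 0 1 - A 1 0) * Complex.I / 2)
        • vecMulVec ![1, Complex.I] (star ![1, Complex.I]) := by
    have hI := Complex.I_mul_I
    ext i j
    simp only [Matrix.add_apply, Matrix.smul_apply, vecMulVec_apply, Pi.star_apply]
    fin_cases i <;> fin_cases j <;> simp <;> grind
  rw [e]
  exact R.add_mem (R.add_mem (R.add_mem (R.smul_mem _ (hv _)) (R.smul_mem _ (hv _)))
    (R.smul_mem _ (hv _))) (R.smul_mem _ (hv _))

/-- Complex span of tensor products of PSD matrices. -/
def psdSpan : Submodule ℂ (Matrix Q3 Q3 ℂ) :=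
  Submodule.span ℂ {X | ∃ A B C : Matrix (Fin 2) (Fin 2) ℂ,
    A.PosSemidef ∧ B.PosSemidef ∧ C.PosSemidef ∧ X = A ⊗ₖ B ⊗ₖ C}

lemma kron_mem (A B C : Matrix (Fin 2) (Fin 2) ℂ) : A ⊗ₖ B ⊗ₖ C ∈ psdSpan := by
  let R1 (B C : Matrix (Fin 2) (Fin 2) ℂ) : Submodule ℂ (Matrix (Fin 2) (Fin 2) ℂ) :=
    { carrier := {A | A ⊗ₖ B ⊗ₖ C ∈ psdSpan}
      add_mem' := fun {a b} ha hb => by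
        simpa [add_kronecker] using psdSpan.add_mem ha hb
      zero_mem' := by simp
      smul_mem' := fun c x hx => by
        simpa [smul_kronecker] using psdSpan.smul_mem c hx }
  let R2 (A C : Matrix (Fin 2) (Fin 2) ℂ) : Submodule ℂ (Matrix (Fin 2) (Fin 2) ℂ) :=
    { carrier := {B | A ⊗ₖ B ⊗ₖ C ∈ psdSpan}
      add_mem' := fun {a b} ha hb => by
        simpa [add_kronecker, kronecker_add] using psdSpan.add_mem ha hb
      zero_mem' := by simp
      smul_mem' := fun c x hx => by
        simpa [smul_kronecker, kronecker_smul] using psdSpan.smul_mem c hx }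
  let R3 (A B : Matrix (Fin 2) (Fin 2) ℂ) : Submodule ℂ (Matrix (Fin 2) (Fin 2) ℂ) :=
    { carrier := {C | A ⊗ₖ B ⊗ₖ C ∈ psdSpan}
      add_mem' := fun {a b} ha hb => by
        simpa [kronecker_add] using psdSpan.add_mem ha hb
      zero_mem' := by simp
      smul_mem' := fun c x hx => by
        simpa [kronecker_smul] using psdSpan.smul_mem c hx }
  refine psd_span (R1 B C) (fun A hA => ?_) A
  refine psd_span (R2 A C) (fun B hB => ?_) B
  refine psd_span (R3 A B) (fun C hC => ?_) C
  exact Submodule.subset_span ⟨A, B, C, hA, hB, hC, rfl⟩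

lemma mem_psdSpan (X : Matrix Q3 Q3 ℂ) : X ∈ psdSpan := by
  rw [matrix_eq_sum_single X]
  refine Submodule.sum_mem _ fun i _ => Submodule.sum_mem _ fun j _ => ?_
  obtain ⟨⟨i1, i2⟩, i3⟩ := i
  obtain ⟨⟨j1, j2⟩, j3⟩ := j
  have := kron_mem (single i1 j1 (X ((i1, i2), i3) ((j1, j2), j3))) (single i2 j2 1)
    (single i3 j3 1)
  simpa [single_kronecker_single] using this

lemma good_herm (X : Matrix Q3 Q3 ℂ) (c : ℂ) : Good (c • X + (c • X)ᴴ) := by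
  have hX := mem_psdSpan X
  unfold psdSpan at hX
  induction hX using Submodule.span_induction generalizing c with
  | mem x h =>
    obtain ⟨A, B, C, hA, hB, hC, rfl⟩ := h
    have e : c • (A ⊗ₖ B ⊗ₖ C) + (c • (A ⊗ₖ B ⊗ₖ C))ᴴ
        = ((2 * c.re : ℝ) : ℂ) • (A ⊗ₖ B ⊗ₖ C) := by
      rw [conjTranspose_smul, conjTranspose_kronecker, conjTranspose_kronecker,
        hA.1.eq, hB.1.eq, hC.1.eq, ← add_smul]
      congr 1
      simpa using Complex.add_conj c
    rw [e]
    exact Good.term _ hA hB hC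
  | zero => simpa using Good.zero
  | add x y _ _ hx hy =>
    have := (hx c).add (hy c)
    convert this using 1
    simp only [smul_add, conjTranspose_add]
    abel
  | smul a x _ hx =>
    have := hx (c * a)
    rwa [mul_smul] at this

/-- Every Hermitian matrix `H` on three qubits can be written as
`H = Y + ∑_{m} ε_m · B_{m1} ⊗ B_{m2} ⊗ B_{m3}`, where each `ε_m ∈ {+1, −1}`, each
`B_{mk}` is a positive semidefinite Hermitian `2×2` matrix, and `Y` is a finite sum of
Hermitian 2-local terms. -/
theorem stmt_13 (H : Matrix Q3 Q3 ℂ) (hH : H.IsHermitian) :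
    ∃ (M : ℕ) (ε : Fin M → ℝ) (B : Fin M → Fin 3 → Matrix (Fin 2) (Fin 2) ℂ)
      (k : ℕ) (y : Fin k → Matrix Q3 Q3 ℂ),
      (∀ m, ε m = 1 ∨ ε m = -1) ∧
      (∀ m j, (B m j).PosSemidef) ∧
      (∀ i, IsTwoLocalTerm (y i)) ∧
      H = (∑ i, y i) + ∑ m, ((ε m : ℝ) : ℂ) • (B m 0 ⊗ₖ B m 1 ⊗ₖ B m 2) := by
  have h := good_herm H (1 / 2)
  have e : (1 / 2 : ℂ) • H + ((1 / 2 : ℂ) • H)ᴴ = H := by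
    rw [conjTranspose_smul, hH.eq, ← add_smul]
    have : (1 / 2 : ℂ) + star (1 / 2 : ℂ) = 1 := by
      simp
      norm_num
    rw [this, one_smul]
  rw [e] at h
  obtain ⟨M, ε, B, h1, h2, h3⟩ := h
  exact ⟨M, ε, B, 0, fun i => i.elim0, h1, h2, fun i => i.elim0, by simpa using h3⟩
end

section
/- Let U be an N×N unitary matrix, and on ℂ^N ⊗ ℂ² define H_out := ½·(I_N ⊗ I₂ − U ⊗ E₁₀ − U† ⊗ E₀₁), where E₁₀ = [[0,0],[1,0]] and E₀₁ = [[0,1],[0,0]]. Then H_out is Hermitian and idempotent (H_out² = H_out), i.e. it is an orthogonal projection; its kernel (the ground eigenspace, for eigenvalue 0) is exactly {v ⊗ e₀ + (Uv) ⊗ e₁ : v ∈ ℂ^N}, an N-dimensional subspace, and its eigenvalue 1 also has multiplicity N. -/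
open Matrix Kronecker

namespace Stmt14

def E10 : Matrix (Fin 2) (Fin 2) ℂ := !![0, 0; 1, 0]
def E01 : Matrix (Fin 2) (Fin 2) ℂ := !![0, 1; 0, 0]

/-- The final Hamiltonian of the one-gate computational-history construction:
`H_out = ½ (I_N ⊗ I₂ − U ⊗ E₁₀ − U† ⊗ E₀₁)` on `ℂ^N ⊗ ℂ²`. -/
noncomputable def Hout (N : ℕ) (U : Matrix (Fin N) (Fin N) ℂ) :
    Matrix (Fin N × Fin 2) (Fin N × Fin 2) ℂ :=
  (1 / 2 : ℂ) • ((1 : Matrix (Fin N × Fin 2) (Fin N × Fin 2) ℂ) - U ⊗ₖ E10 - Uᴴ ⊗ₖ E01)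

/-- The history vector `v ⊗ e₀ + (U v) ⊗ e₁`. -/
noncomputable def histVec (N : ℕ) (U : Matrix (Fin N) (Fin N) ℂ) (v : Fin N → ℂ) :
    Fin N × Fin 2 → ℂ :=
  fun p => (if p.2 = 0 then v p.1 else 0) + (if p.2 = 1 then U.mulVec v p.1 else 0)

/-- Action of `Hout` on clock value 0. -/
lemma Hout_mulVec_zero (N : ℕ) (U : Matrix (Fin N) (Fin N) ℂ) (w : Fin N × Fin 2 → ℂ)
    (i : Fin N) : (Hout N U).mulVec w (i, 0)
      = (1 / 2 : ℂ) * (w (i, 0) - Uᴴ.mulVec (fun j => w (j, 1)) i) := by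
  rw [Hout, Matrix.smul_mulVec, Matrix.sub_mulVec, Matrix.sub_mulVec, Matrix.one_mulVec]
  simp [Matrix.mulVec, dotProduct, Fintype.sum_prod_type, E10, E01]

/-- Action of `Hout` on clock value 1. -/
lemma Hout_mulVec_one (N : ℕ) (U : Matrix (Fin N) (Fin N) ℂ) (w : Fin N × Fin 2 → ℂ)
    (i : Fin N) : (Hout N U).mulVec w (i, 1)
      = (1 / 2 : ℂ) * (w (i, 1) - U.mulVec (fun j => w (j, 0)) i) := by
  rw [Hout, Matrix.smul_mulVec, Matrix.sub_mulVec, Matrix.sub_mulVec, Matrix.one_mulVec]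
  simp [Matrix.mulVec, dotProduct, Fintype.sum_prod_type, E10, E01]

/-- The history map as a linear map. -/
noncomputable def histLin (N : ℕ) (U : Matrix (Fin N) (Fin N) ℂ) :
    (Fin N → ℂ) →ₗ[ℂ] (Fin N × Fin 2 → ℂ) where
  toFun := histVec N U
  map_add' x y := by
    ext ⟨i, k⟩
    fin_cases k <;> simp [histVec, Matrix.mulVec_add]
  map_smul' c x := by
    ext ⟨i, k⟩
    fin_cases k <;> simp [histVec, Matrix.mulVec_smul]

lemma ker_eq (N : ℕ) (U : Matrix (Fin N) (Fin N) ℂ) (hU : Uᴴ * U = 1) :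
    LinearMap.ker (Hout N U).mulVecLin = LinearMap.range (histLin N U) := by
  ext w
  rw [LinearMap.mem_ker, LinearMap.mem_range, Matrix.mulVecLin_apply]
  constructor
  · intro h
    refine ⟨fun j => w (j, 0), ?_⟩
    ext ⟨i, k⟩
    have h1 := congrFun h (i, 1)
    rw [Hout_mulVec_one] at h1
    fin_cases k
    · simp [histLin, histVec]
    · simp [sub_eq_zero] at h1
      simp [histLin, histVec, h1]
  · rintro ⟨v, rfl⟩
    have h0 : (fun j => histLin N U v (j, 0)) = v := by
      ext j
      simp [histLin, histVec]
    have h1 : (fun j => histLin N U v (j, 1)) = U.mulVec v := by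
      ext j
      simp [histLin, histVec]
    ext ⟨i, k⟩
    fin_cases k
    · change (Hout N U).mulVec _ (i, 0) = 0
      rw [Hout_mulVec_zero, h1, Matrix.mulVec_mulVec, hU, Matrix.one_mulVec]
      simp [histLin, histVec]
    · change (Hout N U).mulVec _ (i, 1) = 0
      rw [Hout_mulVec_one, h0]
      simp [histLin, histVec]

lemma finrank_ker (N : ℕ) (U : Matrix (Fin N) (Fin N) ℂ) (hU : Uᴴ * U = 1) :
    Module.finrank ℂ (LinearMap.ker (Hout N U).mulVecLin) = N := by
  rw [ker_eq N U hU, LinearMap.finrank_range_of_inj]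
  · simp
  · intro x y h
    ext i
    simpa [histLin, histVec] using congrFun h (i, 0)

lemma Hout_neg (N : ℕ) (U : Matrix (Fin N) (Fin N) ℂ) : Hout N (-U) = 1 - Hout N U := by
  have h1 : (-U) ⊗ₖ E10 = -(U ⊗ₖ E10) := by ext; simp
  have h2 : (-U)ᴴ ⊗ₖ E01 = -(Uᴴ ⊗ₖ E01) := by ext; simp
  rw [Hout, Hout, h1, h2]
  module

/-- For any `N × N` unitary `U`, the matrix `H_out = ½ (I − U ⊗ E₁₀ − U† ⊗ E₀₁)` is
Hermitian and idempotent (an orthogonal projection); its kernel (the ground eigenspace,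
for eigenvalue 0) is exactly `{v ⊗ e₀ + (U v) ⊗ e₁ : v ∈ ℂ^N}`, an `N`-dimensional
subspace, and its eigenvalue `1` also has multiplicity `N`. -/
theorem stmt_14 (N : ℕ) (U : Matrix (Fin N) (Fin N) ℂ)
    (hU : U ∈ Matrix.unitaryGroup (Fin N) ℂ) :
    (Hout N U).IsHermitian ∧
    Hout N U * Hout N U = Hout N U ∧
    (LinearMap.ker (Hout N U).mulVecLin : Set (Fin N × Fin 2 → ℂ))
      = {w | ∃ v : Fin N → ℂ, w = histVec N U v} ∧
    Module.finrank ℂ (LinearMap.ker (Hout N U).mulVecLin) = N ∧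
    Module.finrank ℂ (Module.End.eigenspace (Hout N U).mulVecLin (1 : ℂ)) = N := by
  have h1 : Uᴴ * U = 1 := Matrix.mem_unitaryGroup_iff'.mp hU
  have h2 : U * Uᴴ = 1 := Matrix.mem_unitaryGroup_iff.mp hU
  refine ⟨?_, ?_, ?_, finrank_ker N U h1, ?_⟩
  · have e1 : E10ᴴ = E01 := by ext i j; fin_cases i <;> fin_cases j <;> simp [E10, E01]
    have e2 : E01ᴴ = E10 := by ext i j; fin_cases i <;> fin_cases j <;> simp [E10, E01]
    rw [Matrix.IsHermitian, Hout, Matrix.conjTranspose_smul, Matrix.conjTranspose_sub,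
      Matrix.conjTranspose_sub, Matrix.conjTranspose_kronecker, Matrix.conjTranspose_kronecker,
      e1, e2, Matrix.conjTranspose_conjTranspose, Matrix.conjTranspose_one, sub_right_comm]
    simp
  · have a1 : E10 * E10 = 0 := by ext i j; fin_cases i <;> fin_cases j <;> simp [E10]
    have a2 : E01 * E01 = 0 := by ext i j; fin_cases i <;> fin_cases j <;> simp [E01]
    have a3 : E10 * E01 + E01 * E10 = 1 := by
      ext i j; fin_cases i <;> fin_cases j <;> simp [E01, E10]
    have b1 : (U ⊗ₖ E10) * (U ⊗ₖ E10) = 0 := by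
      rw [← Matrix.mul_kronecker_mul, a1, Matrix.kronecker_zero]
    have b2 : (Uᴴ ⊗ₖ E01) * (Uᴴ ⊗ₖ E01) = 0 := by
      rw [← Matrix.mul_kronecker_mul, a2, Matrix.kronecker_zero]
    have b3 : (U ⊗ₖ E10) * (Uᴴ ⊗ₖ E01) + (Uᴴ ⊗ₖ E01) * (U ⊗ₖ E10) = 1 := by
      rw [← Matrix.mul_kronecker_mul, ← Matrix.mul_kronecker_mul, h1, h2,
        ← Matrix.kronecker_add, a3, Matrix.one_kronecker_one]
    rw [Hout]
    generalize U ⊗ₖ E10 = A at *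
    generalize Uᴴ ⊗ₖ E01 = B at *
    have key : (1 - A - B) * (1 - A - B) = (2 : ℂ) • (1 - A - B) := by
      have : (1 - A - B) * (1 - A - B)
          = 1 - A - A - B - B + A * A + B * B + (A * B + B * A) := by noncomm_ring
      rw [this, b1, b2, b3]
      module
    rw [Matrix.smul_mul, Matrix.mul_smul, key, smul_smul, smul_smul]
    norm_num
  · rw [ker_eq N U h1]
    ext w
    constructor
    · rintro ⟨v, rfl⟩
      exact ⟨v, rfl⟩
    · rintro ⟨v, rfl⟩
      exact ⟨v, rfl⟩
  · have : Module.End.eigenspace (Hout N U).mulVecLin (1 : ℂ)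
        = LinearMap.ker (Hout N (-U)).mulVecLin := by
      ext w
      rw [Module.End.mem_eigenspace_iff, LinearMap.mem_ker, Matrix.mulVecLin_apply,
        Matrix.mulVecLin_apply, Hout_neg, Matrix.sub_mulVec, Matrix.one_mulVec, one_smul,
        sub_eq_zero, eq_comm]
    rw [this]
    exact finrank_ker N (-U) (by simpa using h1)

end Stmt14
end

section
/- Let P, Q, R be nonnegative reals with PQ = R², let U be an N×N unitary matrix, and on ℂ^N ⊗ ℂ² define H := ½·(P·(I_N ⊗ E₀₀) + Q·(I_N ⊗ E₁₁) − R·(U ⊗ E₁₀) − R·(U† ⊗ E₀₁)), where E₀₀ = [[1,0],[0,0]], E₁₁ = [[0,0],[0,1]], E₁₀ = [[0,0],[1,0]], E₀₁ = [[0,1],[0,0]]. Then H is Hermitian and positive semidefinite, and for any α, β ∈ ℂ satisfying Pα = Rβ and Qβ = Rα, every vector of the form α·(v ⊗ e₀) + β·((Uv) ⊗ e₁) with v ∈ ℂ^N lies in the kernel of H, hence is a ground state of H. -/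
open Matrix Kronecker
open scoped ComplexOrder

namespace Stmt15

def E00 : Matrix (Fin 2) (Fin 2) ℂ := !![1, 0; 0, 0]
def E11 : Matrix (Fin 2) (Fin 2) ℂ := !![0, 0; 0, 1]
def E10 : Matrix (Fin 2) (Fin 2) ℂ := !![0, 0; 1, 0]
def E01 : Matrix (Fin 2) (Fin 2) ℂ := !![0, 1; 0, 0]

/-- The parametrized history Hamiltonian
`H = ½ (P·(I ⊗ E₀₀) + Q·(I ⊗ E₁₁) − R·(U ⊗ E₁₀) − R·(U† ⊗ E₀₁))` on `ℂ^N ⊗ ℂ²`. -/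
noncomputable def Hpqr (N : ℕ) (P Q R : ℝ) (U : Matrix (Fin N) (Fin N) ℂ) :
    Matrix (Fin N × Fin 2) (Fin N × Fin 2) ℂ :=
  (1 / 2 : ℂ) •
    ((P : ℂ) • ((1 : Matrix (Fin N) (Fin N) ℂ) ⊗ₖ E00)
      + (Q : ℂ) • ((1 : Matrix (Fin N) (Fin N) ℂ) ⊗ₖ E11)
      - (R : ℂ) • (U ⊗ₖ E10) - (R : ℂ) • (Uᴴ ⊗ₖ E01))

/-- The tensor `w ⊗ e₀`. -/
def tens0 (N : ℕ) (w : Fin N → ℂ) : Fin N × Fin 2 → ℂ :=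
  fun p => if p.2 = 0 then w p.1 else 0

/-- The tensor `w ⊗ e₁`. -/
def tens1 (N : ℕ) (w : Fin N → ℂ) : Fin N × Fin 2 → ℂ :=
  fun p => if p.2 = 1 then w p.1 else 0

theorem kron_mulVec (N : ℕ) (A : Matrix (Fin N) (Fin N) ℂ) (E : Matrix (Fin 2) (Fin 2) ℂ)
    (a b : Fin N → ℂ) (i : Fin N) (k : Fin 2) :
    ((A ⊗ₖ E) *ᵥ (tens0 N a + tens1 N b)) (i, k)
      = E k 0 * (A *ᵥ a) i + E k 1 * (A *ᵥ b) i := by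
  simp only [Matrix.mulVec, dotProduct, Fintype.sum_prod_type, Fin.sum_univ_two,
    kroneckerMap_apply, Pi.add_apply, tens0, tens1, Finset.mul_sum, ← Finset.sum_add_distrib]
  refine Finset.sum_congr rfl fun j _ => ?_
  simp
  ring

theorem Hpqr_factor (N : ℕ) (P Q R : ℝ) (hP : 0 ≤ P) (hQ : 0 ≤ Q) (hR : 0 ≤ R)
    (hPQR : P * Q = R ^ 2)
    (U : Matrix (Fin N) (Fin N) ℂ) (hU : Uᴴ * U = 1) :
    Hpqr N P Q R U = (1 / 2 : ℂ) •
      ((((√P : ℝ) : ℂ) • (U ⊗ₖ E00) - ((√Q : ℝ) : ℂ) • ((1 : Matrix (Fin N) (Fin N) ℂ) ⊗ₖ E01))ᴴ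
      * (((√P : ℝ) : ℂ) • (U ⊗ₖ E00)
        - ((√Q : ℝ) : ℂ) • ((1 : Matrix (Fin N) (Fin N) ℂ) ⊗ₖ E01))) := by
  have hp : ((√P : ℝ) : ℂ) * ((√P : ℝ) : ℂ) = P := by
    rw [← Complex.ofReal_mul, Real.mul_self_sqrt hP]
  have hq : ((√Q : ℝ) : ℂ) * ((√Q : ℝ) : ℂ) = Q := by
    rw [← Complex.ofReal_mul, Real.mul_self_sqrt hQ]
  have hpq : ((√P : ℝ) : ℂ) * ((√Q : ℝ) : ℂ) = R := by
    rw [← Complex.ofReal_mul, ← Real.sqrt_mul hP, hPQR, Real.sqrt_sq hR]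
  have h00 : E00ᴴ = E00 := by ext i j; fin_cases i <;> fin_cases j <;> simp [E00]
  have h01 : E01ᴴ = E10 := by ext i j; fin_cases i <;> fin_cases j <;> simp [E01, E10]
  have m1 : E00 * E00 = E00 := by
    ext i j; fin_cases i <;> fin_cases j <;> simp [E00]
  have m2 : E00 * E01 = E01 := by
    ext i j; fin_cases i <;> fin_cases j <;> simp [E00, E01]
  have m3 : E10 * E00 = E10 := by
    ext i j; fin_cases i <;> fin_cases j <;> simp [E00, E10]
  have m4 : E10 * E01 = E11 := by
    ext i j; fin_cases i <;> fin_cases j <;> simp [E10, E01, E11]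
  simp only [Hpqr, conjTranspose_sub, conjTranspose_smul, conjTranspose_kronecker, h00, h01,
    conjTranspose_one, sub_mul, mul_sub, smul_mul_assoc, mul_smul_comm, ← mul_kronecker_mul,
    m1, m2, m3, m4, hU, one_mul, mul_one, RCLike.star_def, Complex.conj_ofReal]
  congr 1
  rw [← hp, ← hq, ← hpq]
  module

/-- Let `P, Q, R ≥ 0` with `PQ = R²` and let `U` be unitary.  Then
`H = ½ (P·(I⊗E₀₀) + Q·(I⊗E₁₁) − R·(U⊗E₁₀) − R·(U†⊗E₀₁))` is Hermitian and positive
semidefinite, and for any `α, β ∈ ℂ` with `Pα = Rβ` and `Qβ = Rα`, every vector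
`α·(v ⊗ e₀) + β·((U v) ⊗ e₁)` lies in the kernel of `H`, hence is a ground state. -/
theorem stmt_15 (N : ℕ) (P Q R : ℝ) (hP : 0 ≤ P) (hQ : 0 ≤ Q) (hR : 0 ≤ R)
    (hPQR : P * Q = R ^ 2)
    (U : Matrix (Fin N) (Fin N) ℂ) (hU : U ∈ Matrix.unitaryGroup (Fin N) ℂ) :
    (Hpqr N P Q R U).IsHermitian ∧
    (Hpqr N P Q R U).PosSemidef ∧
    (∀ (α β : ℂ) (v : Fin N → ℂ), (P : ℂ) * α = (R : ℂ) * β →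
      (Q : ℂ) * β = (R : ℂ) * α →
      (Hpqr N P Q R U).mulVec (α • tens0 N v + β • tens1 N (U.mulVec v)) = 0) := by
  have hU' : Uᴴ * U = 1 := by
    simpa [star_eq_conjTranspose] using (Matrix.mem_unitaryGroup_iff').1 hU
  have hpsd : (Hpqr N P Q R U).PosSemidef := by
    rw [Hpqr_factor N P Q R hP hQ hR hPQR U hU']
    refine (posSemidef_conjTranspose_mul_self _).smul ?_
    have : (0 : ℂ) ≤ ((1 / 2 : ℝ) : ℂ) := by
      rw [Complex.zero_le_real]; norm_num
    simpa using this
  refine ⟨hpsd.isHermitian, hpsd, fun α β v h1 h2 => ?_⟩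
  have e0 : α • tens0 N v = tens0 N (α • v) := by
    ext p; simp [tens0]
  have e1 : β • tens1 N (U *ᵥ v) = tens1 N (β • (U *ᵥ v)) := by
    ext p; simp [tens1]
  rw [e0, e1]
  ext ⟨i, k⟩
  simp only [Hpqr, smul_mulVec, sub_mulVec, add_mulVec, Pi.smul_apply, Pi.sub_apply,
    Pi.add_apply, kron_mulVec, mulVec_smul, mulVec_mulVec, hU', one_mulVec, smul_eq_mul,
    Pi.zero_apply]
  fin_cases k
  · simp [E00, E11, E10, E01]
    linear_combination v i * h1
  · simp [E00, E11, E10, E01]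
    linear_combination (U *ᵥ v) i * h2

end Stmt15
end
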